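/- (Alsedà–Llibre corollary.) Let T(x,y) = (f(x), g(x,y)) be a continuous triangular map on I × I. Then a natural number n belongs to Per(T) if and only if there exist a periodic point x of f of minimal period p, with f-orbit P = {x, f(x), …, f^{p−1}(x)} listed starting at x, and a periodic point y of g_P of minimal period q, such that n = p·q. In other words, Per(T) = ⋃_{P ∈ Orb(f), Q ∈ Orb(g_P)} |P|·|Q|. -/

import Mathlib

open Function

/-- The unit interval `[0,1]`. -/
local notation "I" => unitInterval

/-- The triangular map `T(x,y) = (f x, g (x,y))` on `I × I`. -/
def triMap (f : I → I) (g : I × I → I) : I × I → I × I :=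
  fun z => (f z.1, g z)

/-- Given the fiber map `g` and points `x 0, …, x (p-1)`, the map
`g_P(y) = g(x_{p-1}, g(x_{p-2}, …, g(x₁, g(x₀, y))…))`. -/
def fiberComp (g : I × I → I) (p : ℕ) (x : ℕ → I) (y : I) : I :=
  (List.range p).foldl (fun z i => g (x i, z)) y

/-- `z` is a periodic point of `F` of minimal period `n`:
`F^[n] z = z` and `F^[k] z ≠ z` for `0 < k < n`. -/
def MinPeriod {X : Type*} (F : X → X) (z : X) (n : ℕ) : Prop :=
  0 < n ∧ F^[n] z = z ∧ ∀ k, 0 < k → k < n → F^[k] z ≠ z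

theorem minPeriod_iff {X : Type*} (F : X → X) (z : X) (n : ℕ) :
    MinPeriod F z n ↔ 0 < n ∧ minimalPeriod F z = n := by
  constructor
  · rintro ⟨hn, hz, hmin⟩
    refine ⟨hn, le_antisymm (IsPeriodicPt.minimalPeriod_le hn hz) (not_lt.mp fun hlt => ?_)⟩
    exact hmin _ (IsPeriodicPt.minimalPeriod_pos hn hz) hlt iterate_minimalPeriod
  · rintro ⟨hn, rfl⟩
    exact ⟨hn, iterate_minimalPeriod, fun k hk hlt =>
      not_isPeriodicPt_of_pos_of_lt_minimalPeriod hk.ne' hlt⟩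

theorem triMap_iterate (f : I → I) (g : I × I → I) (x y : I) (m : ℕ) :
    (triMap f g)^[m] (x, y) = (f^[m] x, fiberComp g m (fun i => f^[i] x) y) := by
  induction m with
  | zero => rfl
  | succ m ih =>
    rw [iterate_succ_apply', ih, iterate_succ_apply']
    simp [triMap, fiberComp, List.range_succ]

theorem triMap_iterate_mul (f : I → I) (g : I × I → I) (x y : I) {p : ℕ}
    (hx : IsPeriodicPt f p x) (k : ℕ) :
    (triMap f g)^[p * k] (x, y) = (x, (fiberComp g p (fun i => f^[i] x))^[k] y) := by
  induction k with
  | zero => rfl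
  | succ k ih =>
    rw [Nat.mul_succ, Nat.add_comm, iterate_add_apply, ih, triMap_iterate, iterate_succ_apply',
      hx.eq]

theorem minimalPeriod_triMap (f : I → I) (g : I × I → I) (x y : I) :
    minimalPeriod (triMap f g) (x, y) = minimalPeriod f x *
      minimalPeriod (fiberComp g (minimalPeriod f x) (fun i => f^[i] x)) y := by
  have hx := isPeriodicPt_minimalPeriod f x
  apply dvd_antisymm
  · apply IsPeriodicPt.minimalPeriod_dvd
    rw [IsPeriodicPt, IsFixedPt, triMap_iterate_mul f g x y hx, iterate_minimalPeriod]
  · have h : (triMap f g)^[minimalPeriod (triMap f g) (x, y)] (x, y) = (x, y) :=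
      iterate_minimalPeriod
    have hfst := h
    rw [triMap_iterate] at hfst
    obtain ⟨k, hk⟩ := IsPeriodicPt.minimalPeriod_dvd (congrArg Prod.fst hfst :)
    rw [hk, triMap_iterate_mul f g x y hx] at h
    rw [hk]
    exact Nat.mul_dvd_mul_left _ (IsPeriodicPt.minimalPeriod_dvd (congrArg Prod.snd h :))

/-- Alsedà–Llibre corollary: `n ∈ Per T` iff there exist a periodic point `x` of `f` of
minimal period `p`, with `f`-orbit `P = {x, f x, …, f^[p-1] x}` listed starting at `x`,
and a periodic point `y` of `g_P` of minimal period `q`, such that `n = p * q`. -/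
theorem triMap_periods (f : I → I) (g : I × I → I)
    (hf : Continuous f) (hg : Continuous g) (n : ℕ) :
    (∃ z : I × I, MinPeriod (triMap f g) z n) ↔
      ∃ (x : I) (p : ℕ) (y : I) (q : ℕ),
        MinPeriod f x p ∧
        MinPeriod (fiberComp g p (fun i => f^[i] x)) y q ∧
        n = p * q := by
  simp only [minPeriod_iff]
  constructor
  · rintro ⟨⟨x, y⟩, hn, hz⟩
    have hT : (triMap f g)^[n] (x, y) = (x, y) := hz ▸ iterate_minimalPeriod
    rw [triMap_iterate] at hT
    have hp : 0 < minimalPeriod f x :=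
      IsPeriodicPt.minimalPeriod_pos hn (congrArg Prod.fst hT :)
    rw [minimalPeriod_triMap f g x y] at hz
    exact ⟨x, _, y, _, ⟨hp, rfl⟩, ⟨Nat.pos_of_mul_pos_left (hz ▸ hn), rfl⟩, hz.symm⟩
  · rintro ⟨x, p, y, q, ⟨hp, rfl⟩, ⟨hq, rfl⟩, rfl⟩
    exact ⟨(x, y), Nat.mul_pos hp hq, minimalPeriod_triMap f g x y⟩
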